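/- arXiv:1806.11470 — 2 statements merged into one kernel-verified Lean document; each statement's English description precedes it below -/
import Mathlib

section
/- Let a > 0 and λ > 0. Then lim_{T → ∞} −(1/T) · ln( (λT)^{⌊aT⌋} · e^{−λT} / (⌊aT⌋)! ) = a·ln(a/λ) − a + λ, where ⌊·⌋ denotes the floor function and (⌊aT⌋)! the factorial. -/
open Filter Real

/-- Leading-order Stirling formula on the logarithmic scale. -/
theorem tendsto_log_factorial_div_sub_log :
    Tendsto (fun n : ℕ => Real.log n.factorial / n - Real.log n) atTop (nhds (-1)) := by
  have hstirling : Tendsto (fun n : ℕ => Real.log (Stirling.stirlingSeq n) / n)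
      atTop (nhds 0) :=
    (Stirling.tendsto_stirlingSeq_sqrt_pi.log (by positivity)).div_atTop
      tendsto_natCast_atTop_atTop
  have hlog : Tendsto (fun n : ℕ => Real.log (2 * n) / (2 * n)) atTop (nhds 0) :=
    isLittleO_log_id_atTop.tendsto_div_nhds_zero.comp
      (tendsto_natCast_atTop_atTop.const_mul_atTop (by norm_num : (0 : ℝ) < 2))
  have hsum := (hstirling.add hlog).sub_const 1
  rw [add_zero, zero_sub] at hsum
  refine hsum.congr' ?_
  filter_upwards [eventually_gt_atTop 0] with n hn
  have hn' : (0 : ℝ) < n := by exact_mod_cast hn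
  rw [Stirling.log_stirlingSeq_formula, Real.log_div hn'.ne' (exp_pos 1).ne', Real.log_exp]
  field_simp
  ring

/-- Large deviation rate of a Poisson distribution of mean `λT` evaluated at `⌊aT⌋`:
`lim_{T → ∞} −(1/T) ln( (λT)^{⌊aT⌋} e^{−λT} / ⌊aT⌋! ) = a ln(a/λ) − a + λ`. -/
theorem poisson_large_deviation_rate (a l : ℝ) (ha : 0 < a) (hl : 0 < l) :
    Tendsto (fun T : ℝ =>
        -(1 / T) * Real.log ((l * T) ^ ⌊a * T⌋₊ * exp (-(l * T)) / (Nat.factorial ⌊a * T⌋₊)))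
      atTop (nhds (a * Real.log (a / l) - a + l)) := by
  have hfloor : Tendsto (fun T : ℝ => ⌊a * T⌋₊) atTop atTop :=
    tendsto_nat_floor_atTop.comp (tendsto_id.const_mul_atTop ha)
  have hratio : Tendsto (fun T : ℝ => (⌊a * T⌋₊ : ℝ) / T) atTop (nhds a) :=
    tendsto_nat_floor_mul_div_atTop ha.le
  have hsum := ((hratio.mul (tendsto_log_factorial_div_sub_log.comp hfloor)).add
    (hratio.mul ((hratio.log ha.ne').sub_const (Real.log l)))).add_const l
  have hlimit : a * -1 + a * (Real.log a - Real.log l) + l = a * Real.log (a / l) - a + l := by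
    rw [Real.log_div ha.ne' hl.ne']
    ring
  rw [hlimit] at hsum
  refine hsum.congr' ?_
  filter_upwards [eventually_gt_atTop 0, hfloor.eventually_gt_atTop 0] with T hT hn
  simp only [Function.comp_apply]
  generalize ⌊a * T⌋₊ = n at hn ⊢
  have hn' : (0 : ℝ) < n := by exact_mod_cast hn
  have hfact : (n.factorial : ℝ) ≠ 0 := by positivity
  rw [Real.log_div (by positivity) hfact, Real.log_mul (by positivity) (exp_pos _).ne',
    Real.log_exp, Real.log_pow, Real.log_mul hl.ne' hT.ne', Real.log_div hn'.ne' hT.ne']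
  field_simp
  ring
end

section
/- Define φ : ℝ → ℝ by φ(γ) = e^γ − 1 for γ < 0 and φ(γ) = 2(e^γ − 1) for γ ≥ 0. Then for a > 0 the Legendre–Fenchel transform I_c(a) = sup_{γ ∈ ℝ} ( aγ − φ(γ) ) equals: a·ln a − a + 1 if 0 < a < 1; 0 if 1 ≤ a ≤ 2; and a·ln(a/2) − a + 2 if a > 2. In particular I_c is convex and vanishes identically on the interval [1,2]. -/
open Real

/-- Young's inequality for the Poisson rate function with intensity `r`. -/
lemma mul_sub_poisson_cgf_le {a r : ℝ} (ha : 0 < a) (hr : 0 < r) (γ : ℝ) :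
    a * γ - r * (exp γ - 1) ≤ a * Real.log (a / r) - a + r := by
  have hexp : a * exp (γ - Real.log (a / r)) = r * exp γ := by
    rw [exp_sub, exp_log (div_pos ha hr)]
    field_simp
  have hle := mul_le_mul_of_nonneg_left (add_one_le_exp (γ - Real.log (a / r))) ha.le
  linarith

/-- The Legendre–Fenchel transform is convex on any convex set where it is finite. -/
lemma convexOn_sSup_range_mul_sub {s : Set ℝ} (hs : Convex ℝ s) (φ : ℝ → ℝ)
    (hbdd : ∀ a ∈ s, BddAbove (Set.range fun γ : ℝ => a * γ - φ γ)) :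
    ConvexOn ℝ s fun a => sSup (Set.range fun γ : ℝ => a * γ - φ γ) := by
  refine ⟨hs, fun x hx y hy p q hp hq hpq => csSup_le (Set.range_nonempty _) ?_⟩
  rintro _ ⟨γ, rfl⟩
  have hxγ := mul_le_mul_of_nonneg_left (le_csSup (hbdd x hx) ⟨γ, rfl⟩) hp
  have hyγ := mul_le_mul_of_nonneg_left (le_csSup (hbdd y hy) ⟨γ, rfl⟩) hq
  have hsplit : (p * x + q * y) * γ - φ γ = p * (x * γ - φ γ) + q * (y * γ - φ γ) := by
    linear_combination φ γ * hpq
  simp only [smul_eq_mul] at *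
  linarith

/-- The Legendre–Fenchel transform `I_c a = sup_γ (aγ − φ(γ))` of the non-differentiable
scaled cumulant generating function `φ(γ) = e^γ − 1` for `γ < 0`, `φ(γ) = 2(e^γ − 1)` for
`γ ≥ 0`, is given piecewise by the Poisson rate functions, is convex on `(0,∞)` and
vanishes identically on `[1,2]`. -/
theorem canonical_activity_ldf_four_state
    (φ : ℝ → ℝ) (hφ : ∀ γ : ℝ, φ γ = if γ < 0 then exp γ - 1 else 2 * (exp γ - 1))
    (Ic : ℝ → ℝ) (hIc : ∀ a : ℝ, Ic a = sSup (Set.range fun γ : ℝ => a * γ - φ γ)) :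
    (∀ a : ℝ, 0 < a → a < 1 → Ic a = a * Real.log a - a + 1) ∧
    (∀ a : ℝ, 1 ≤ a → a ≤ 2 → Ic a = 0) ∧
    (∀ a : ℝ, 2 < a → Ic a = a * Real.log (a / 2) - a + 2) ∧
    ConvexOn ℝ (Set.Ioi (0 : ℝ)) Ic := by
  have hone (γ : ℝ) : exp γ - 1 ≤ φ γ := by
    rw [hφ]
    split_ifs with h
    · exact le_rfl
    · linarith [one_le_exp (not_lt.mp h)]
  have htwo (γ : ℝ) : 2 * (exp γ - 1) ≤ φ γ := by
    rw [hφ]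
    split_ifs with h
    · linarith [exp_lt_one_iff.mpr h]
    · exact le_rfl
  have hIc_eq {a c : ℝ} (γ₀ : ℝ) (hattained : a * γ₀ - φ γ₀ = c)
      (hle : ∀ γ, a * γ - φ γ ≤ c) : Ic a = c := by
    rw [hIc]
    refine IsGreatest.csSup_eq ⟨⟨γ₀, hattained⟩, ?_⟩
    rintro _ ⟨γ, rfl⟩
    exact hle γ
  refine ⟨fun a h0 h1 => ?_, fun a h1 h2 => ?_, fun a h2 => ?_, ?_⟩
  · refine hIc_eq (Real.log a) ?_ fun γ => ?_
    · rw [hφ, if_pos (log_neg h0 h1), exp_log h0]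
      ring
    · have hyoung := mul_sub_poisson_cgf_le h0 one_pos γ
      rw [div_one] at hyoung
      linarith [hone γ]
  · refine hIc_eq 0 (by simp [hφ]) fun γ => ?_
    rcases lt_or_ge γ 0 with h | h
    · nlinarith [hone γ, add_one_le_exp γ]
    · nlinarith [htwo γ, add_one_le_exp γ]
  · have h0 : 0 < a := by linarith
    refine hIc_eq (Real.log (a / 2)) ?_ fun γ => ?_
    · rw [hφ, if_neg (not_lt.mpr (log_nonneg (by linarith))), exp_log (by linarith)]
      ring
    · linarith [mul_sub_poisson_cgf_le h0 two_pos γ, htwo γ]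
  · rw [funext hIc]
    refine convexOn_sSup_range_mul_sub (convex_Ioi 0) φ fun a ha => ?_
    refine ⟨a * Real.log (a / 1) - a + 1, ?_⟩
    rintro _ ⟨γ, rfl⟩
    have hyoung := mul_sub_poisson_cgf_le ha one_pos γ
    simp only
    linarith [hone γ]
end
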